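/- arXiv:math/0304459 — 3 statements merged into one kernel-verified Lean document; each statement's English description precedes it below -/
import Mathlib

section
/- Let E be a finite-dimensional real normed vector space, S > 0, and let f : E × [0,S] → E be a C² time-dependent vector field. Let Z : E × [0,S] → E satisfy ∂Z/∂s(z,s) = f(Z(z,s), s) and Z(z,0) = z for all z ∈ E and s ∈ [0,S] (so z ↦ Z(z,s) is the shift along solutions of the auxiliary equation, the Lie method). Let û : E → E be a C¹ vector field and suppose u : E × [0,S] → E is C¹ and satisfies, for all z and s, u(Z(z,s), s) = D_z Z(z,s)(û(z)), i.e. the change of variables z ↦ Z(z,s) transforms the system ż = û(z) into ż = u(z,s). Then u(·,0) = û and for all z ∈ E and s ∈ [0,S], ∂u/∂s(Z(z,s), s) = [u(·,s), f(·,s)](Z(z,s)). -/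
open Set Function

open Filter Topology Metric
open scoped NNReal

/-- The radial retraction onto the closed ball of radius `R` is `2`-Lipschitz. -/
theorem norm_radial_retraction_sub_le {F : Type*} [NormedAddCommGroup F] [NormedSpace ℝ F]
    {R : ℝ} (hR : 0 < R) (x y : F) :
    ‖(R / max R ‖x‖) • x - (R / max R ‖y‖) • y‖ ≤ 2 * ‖x - y‖ := by
  set m := max R ‖x‖ with hm
  set m' := max R ‖y‖ with hm'
  have hmR : R ≤ m := le_max_left _ _
  have hmR' : R ≤ m' := le_max_left _ _
  have hy : ‖y‖ ≤ m' := le_max_right _ _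
  have hm0 : 0 < m := hR.trans_le hmR
  have hm0' : 0 < m' := hR.trans_le hmR'
  have hmm : |m' - m| ≤ ‖x - y‖ := by
    rw [abs_sub_comm]
    calc |m - m'| ≤ max |R - R| |‖x‖ - ‖y‖| := abs_max_sub_max_le_max _ _ _ _
      _ ≤ ‖x - y‖ := by simpa using abs_norm_sub_norm_le x y
  have hdecomp : (R / m) • x - (R / m') • y
      = (R / m) • (x - y) + ((R / m) * ((m' - m) / m')) • y := by
    rw [smul_sub, sub_add, ← sub_smul]
    congr 2
    field_simp
    ring
  have h1 : R / m ≤ 1 := (div_le_one hm0).2 hmR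
  have h0 : 0 ≤ R / m := by positivity
  have h2 : ‖((m' - m) / m') • y‖ ≤ ‖x - y‖ := by
    rw [norm_smul, norm_div, Real.norm_eq_abs, Real.norm_eq_abs, abs_of_pos hm0',
      div_mul_eq_mul_div, div_le_iff₀ hm0']
    exact mul_le_mul hmm hy (norm_nonneg _) (norm_nonneg _)
  rw [hdecomp, mul_smul, ← smul_add, norm_smul, Real.norm_of_nonneg h0]
  calc R / m * ‖(x - y) + ((m' - m) / m') • y‖ ≤ 1 * (‖x - y‖ + ‖x - y‖) :=
        mul_le_mul h1 ((norm_add_le _ _).trans (by gcongr)) (norm_nonneg _) zero_le_one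
    _ = 2 * ‖x - y‖ := by ring

theorem norm_radial_retraction_le {F : Type*} [NormedAddCommGroup F] [NormedSpace ℝ F]
    {R : ℝ} (hR : 0 < R) (x : F) :
    ‖(R / max R ‖x‖) • x‖ ≤ R ∧ ‖(R / max R ‖x‖) • x‖ ≤ ‖x‖ := by
  have hm0 : 0 < max R ‖x‖ := hR.trans_le (le_max_left _ _)
  rw [norm_smul, Real.norm_of_nonneg (by positivity), div_mul_eq_mul_div, div_le_iff₀ hm0,
    div_le_iff₀ hm0, mul_comm ‖x‖]
  exact ⟨by gcongr; exact le_max_right _ _, by gcongr; exact le_max_left _ _⟩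

theorem HasDerivWithinAt.Ici_of_Icc {F : Type*} [NormedAddCommGroup F] [NormedSpace ℝ F]
    {y : ℝ → F} {y' : F} {a b t : ℝ} (h : HasDerivWithinAt y y' (Icc a b) t)
    (ht : t ∈ Ico a b) : HasDerivWithinAt y y' (Ici t) t :=
  h.mono_of_mem_nhdsWithin (Icc_mem_nhdsGE_of_mem ht)

/-- Global existence for linear differential equations on a compact interval. -/
theorem exists_hasDerivWithinAt_linear {F : Type*} [NormedAddCommGroup F] [NormedSpace ℝ F]
    [CompleteSpace F] {S : ℝ} (hS : 0 ≤ S) {B : ℝ → F →L[ℝ] F} (hB : ContinuousOn B (Icc 0 S))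
    (w : F) :
    ∃ Y : ℝ → F, Y 0 = w ∧ ∀ t ∈ Icc 0 S, HasDerivWithinAt Y (B t (Y t)) (Icc 0 S) t := by
  obtain ⟨M, hM⟩ : ∃ M : ℝ≥0, ∀ t ∈ Icc 0 S, ‖B t‖ ≤ M := by
    obtain ⟨C, hC⟩ := isCompact_Icc.exists_bound_of_continuousOn hB
    exact ⟨C.toNNReal, fun t ht => (hC t ht).trans (Real.le_coe_toNNReal C)⟩
  obtain ⟨R, hR⟩ : ∃ R : ℝ≥0, (R : ℝ) = (‖w‖ + 1) * Real.exp (M * S) :=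
    ⟨⟨_, by positivity⟩, rfl⟩
  have hR0 : (0 : ℝ) < R := by rw [hR]; positivity
  let ρ : F → F := fun x => ((R : ℝ) / max (R : ℝ) ‖x‖) • x
  have hPL : IsPicardLindelof (fun t x => B t (ρ x)) (⟨0, left_mem_Icc.2 hS⟩ : Icc 0 S) w
      (M * R * ⟨S, hS⟩) 0 (M * R) (M * 2) := by
    refine ⟨fun t ht => LipschitzWith.lipschitzOnWith ?_, fun x _ => hB.clm_apply
      continuousOn_const, fun t ht x _ => ?_, ?_⟩
    · refine LipschitzWith.of_dist_le_mul fun x y => ?_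
      rw [dist_eq_norm, dist_eq_norm, ← map_sub]
      calc ‖B t (ρ x - ρ y)‖ ≤ M * (2 * ‖x - y‖) :=
            (B t).le_of_opNorm_le_of_le (hM t ht) (norm_radial_retraction_sub_le hR0 x y)
        _ = _ := by push_cast; ring
    · exact (B t).le_of_opNorm_le_of_le (hM t ht) (norm_radial_retraction_le hR0 x).1
    · simp only [sub_zero, sub_self, max_eq_left hS, NNReal.coe_mul, NNReal.coe_zero]
      exact le_rfl
  obtain ⟨Y, hY0, hY⟩ := hPL.exists_eq_forall_mem_Icc_hasDerivWithinAt₀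
  have hbound : ∀ t ∈ Icc 0 S, ‖Y t‖ ≤ R := by
    intro t ht
    have := norm_le_gronwallBound_of_norm_deriv_right_le (δ := ‖w‖) (K := M) (ε := 0)
      (fun s hs => (hY s hs).continuousWithinAt)
      (fun s hs => (hY s (Ico_subset_Icc_self hs)).Ici_of_Icc hs)
      (by rw [← hY0]) (fun s hs => by
        rw [add_zero]
        exact (B s).le_of_opNorm_le_of_le (hM s (Ico_subset_Icc_self hs))
          (norm_radial_retraction_le hR0 _).2) t ht
    rw [gronwallBound_ε0, sub_zero] at this
    refine this.trans ?_
    rw [hR]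
    gcongr
    · linarith
    · exact ht.2
  refine ⟨Y, hY0, fun t ht => ?_⟩
  convert hY t ht using 2
  simp only [ρ]
  rw [max_eq_left (hbound t ht), div_self hR0.ne', one_smul]

/-- First-order expansion of a time-dependent `C¹` vector field along a curve, uniformly in
time. -/
theorem exists_uniform_remainder_along_curve {E : Type*} [NormedAddCommGroup E] [NormedSpace ℝ E]
    {S : ℝ} {f : E → ℝ → E} {g : E → ℝ → E →L[ℝ] E}
    (hfg : ∀ x, ∀ s ∈ Icc 0 S, HasFDerivAt (fun x => f x s) (g x s) x)
    (hg : ContinuousOn (fun p : E × ℝ => g p.1 p.2) (univ ×ˢ Icc 0 S))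
    {γ : ℝ → E} (hγ : ContinuousOn γ (Icc 0 S)) {c : ℝ} (hc : 0 < c) :
    ∃ r > 0, ∀ s ∈ Icc 0 S, ∀ y, ‖y - γ s‖ < r →
      ‖f y s - f (γ s) s - g (γ s) s (y - γ s)‖ ≤ c * ‖y - γ s‖ := by
  have hG : ContinuousOn (fun p : E × ℝ => g (γ p.2 + p.1) p.2 - g (γ p.2) p.2)
      (univ ×ˢ Icc 0 S) := by
    have hγ' : ContinuousOn (fun p : E × ℝ => γ p.2) (univ ×ˢ Icc 0 S) :=
      hγ.comp continuousOn_snd fun p hp => hp.2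
    exact (hg.comp ((hγ'.add continuousOn_fst).prodMk continuousOn_snd)
      fun p hp => ⟨mem_univ _, hp.2⟩).sub
      (hg.comp (hγ'.prodMk continuousOn_snd) fun p hp => ⟨mem_univ _, hp.2⟩)
  have hev : ∀ᶠ v in 𝓝 (0 : E), ∀ s ∈ Icc 0 S, s ∈ Icc 0 S →
      ‖g (γ s + v) s - g (γ s) s‖ < c := by
    refine isCompact_Icc.eventually_forall_of_forall_eventually fun s hs => ?_
    have h := (hG (0, s) ⟨mem_univ _, hs⟩).norm.eventually_lt_const
      (show ‖g (γ s + 0) s - g (γ s) s‖ < c by simpa using hc)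
    filter_upwards [eventually_nhdsWithin_iff.1 h] with p hp hps using hp ⟨mem_univ _, hps⟩
  obtain ⟨r, hr, hball⟩ := Metric.eventually_nhds_iff_ball.1 hev
  refine ⟨r, hr, fun s hs y hy => ?_⟩
  refine (convex_ball (γ s) r).norm_image_sub_le_of_norm_hasFDerivWithin_le'
    (fun x _ => (hfg x s hs).hasFDerivWithinAt) (fun x hx => ?_) (mem_ball_self hr)
    (mem_ball_iff_norm.2 hy)
  have := hball (x - γ s) (by simpa using mem_ball_iff_norm.1 hx) s hs hs
  rw [add_sub_cancel] at this
  exact this.le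

/-- Differentiability of a flow with respect to the initial condition, together with the
variational equation satisfied by the derivative. -/
theorem exists_hasFDerivAt_flow {E : Type*} [NormedAddCommGroup E] [NormedSpace ℝ E]
    [CompleteSpace E] {S : ℝ} (hS : 0 ≤ S) {f : E → ℝ → E} {g : E → ℝ → E →L[ℝ] E}
    (hfg : ∀ x, ∀ s ∈ Icc 0 S, HasFDerivAt (fun x => f x s) (g x s) x)
    (hg : ContinuousOn (fun p : E × ℝ => g p.1 p.2) (univ ×ˢ Icc 0 S))
    {Z : E → ℝ → E} (hZ0 : ∀ z, Z z 0 = z)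
    (hZ : ∀ z, ∀ s ∈ Icc 0 S, HasDerivWithinAt (Z z) (f (Z z s) s) (Icc 0 S) s) (z : E) :
    ∃ Y : ℝ → E →L[ℝ] E, ∀ s ∈ Icc 0 S, HasFDerivAt (fun z => Z z s) (Y s) z ∧
      HasDerivWithinAt Y (g (Z z s) s ∘L Y s) (Icc 0 S) s := by
  have hZc : ∀ z, ContinuousOn (Z z) (Icc 0 S) := fun z s hs => (hZ z s hs).continuousWithinAt
  have hA : ContinuousOn (fun s => g (Z z s) s) (Icc 0 S) :=
    hg.comp ((hZc z).prodMk continuousOn_id) fun s hs => ⟨mem_univ _, hs⟩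
  obtain ⟨M, hM0, hM⟩ : ∃ M : ℝ, 0 < M ∧ ∀ s ∈ Icc 0 S, ‖g (Z z s) s‖ ≤ M := by
    obtain ⟨C, hC⟩ := isCompact_Icc.exists_bound_of_continuousOn hA
    exact ⟨max C 1, by positivity, fun s hs => (hC s hs).trans (le_max_left _ _)⟩
  obtain ⟨Y, hY0, hY⟩ := exists_hasDerivWithinAt_linear hS
    (B := fun s => ContinuousLinearMap.compL ℝ E E E (g (Z z s) s))
    ((ContinuousLinearMap.compL ℝ E E E).continuous.comp_continuousOn hA)
    (ContinuousLinearMap.id ℝ E)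
  refine ⟨Y, fun t ht => ⟨?_, hY t ht⟩⟩
  have hsub : ∀ h, ∀ s ∈ Icc 0 S, HasDerivWithinAt (fun s => Z (z + h) s - Z z s)
      (f (Z (z + h) s) s - f (Z z s) s) (Icc 0 S) s :=
    fun h s hs => (hZ (z + h) s hs).sub (hZ z s hs)
  obtain ⟨r₁, hr₁, hrem₁⟩ := exists_uniform_remainder_along_curve hfg hg (hZc z) one_pos
  set L := Real.exp ((M + 2) * S) with hL
  have hL0 : 0 < L := Real.exp_pos _
  have hlip : ∀ h, ‖h‖ * L < r₁ → ∀ s ∈ Icc 0 S, ‖Z (z + h) s - Z z s‖ ≤ ‖h‖ * L := by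
    intro h hh s hs
    rcases eq_or_ne h 0 with rfl | h0
    · simp
    have hexp : ∀ s ≤ S, ‖h‖ * Real.exp ((M + 2) * s) ≤ ‖h‖ * L := fun s hs => by
      rw [hL]; gcongr
    refine le_trans ?_ (hexp s hs.2)
    refine image_norm_le_of_norm_deriv_right_lt_deriv_boundary
      (B := fun s => ‖h‖ * Real.exp ((M + 2) * s))
      (B' := fun s => ‖h‖ * (Real.exp ((M + 2) * s) * ((M + 2) * 1)))
      (fun s hs => (hsub h s hs).continuousWithinAt)
      (fun s hs => (hsub h s (Ico_subset_Icc_self hs)).Ici_of_Icc hs) (by simp [hZ0])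
      (fun s => (((hasDerivAt_id s).const_mul (M + 2)).exp).const_mul ‖h‖) ?_ hs
    intro s hs heq
    have hs' := Ico_subset_Icc_self hs
    have h1 := hrem₁ s hs' (Z (z + h) s) (by rw [heq]; exact (hexp s hs.2.le).trans_lt hh)
    have h2 := (g (Z z s) s).le_of_opNorm_le (hM s hs') (Z (z + h) s - Z z s)
    have h3 := norm_le_norm_sub_add (f (Z (z + h) s) s - f (Z z s) s)
      (g (Z z s) s (Z (z + h) s - Z z s))
    have h4 : 0 < ‖h‖ * Real.exp ((M + 2) * s) := by positivity
    rw [heq] at h1 h2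
    linarith
  rw [hasFDerivAt_iff_isLittleO_nhds_zero, Asymptotics.isLittleO_iff]
  intro c hc
  set D := L / M * Real.exp (M * S) with hD
  have hD0 : 0 < D := by positivity
  obtain ⟨r₂, hr₂, hrem₂⟩ := exists_uniform_remainder_along_curve hfg hg (hZc z)
    (div_pos hc hD0)
  have hsmall : ∀ᶠ h in 𝓝 (0 : E), ‖h‖ * L < min r₁ r₂ := by
    have : Continuous fun h : E => ‖h‖ * L := by fun_prop
    exact this.continuousAt.eventually_lt continuousAt_const (by simp [hr₁, hr₂])
  filter_upwards [hsmall] with h hh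
  have hη : ∀ s ∈ Icc 0 S, HasDerivWithinAt (fun s => Z (z + h) s - Z z s - Y s h)
      (f (Z (z + h) s) s - f (Z z s) s - g (Z z s) s (Y s h)) (Icc 0 S) s := fun s hs =>
    (hsub h s hs).sub ((ContinuousLinearMap.apply ℝ E h).hasFDerivAt.comp_hasDerivWithinAt s
      (hY s hs))
  have hgr := norm_le_gronwallBound_of_norm_deriv_right_le (δ := 0) (K := M)
    (ε := c / D * (‖h‖ * L)) (fun s hs => (hη s hs).continuousWithinAt)
    (fun s hs => (hη s (Ico_subset_Icc_self hs)).Ici_of_Icc hs) (by simp [hZ0, hY0])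
    (fun s hs => by
      have hs' := Ico_subset_Icc_self hs
      have hl := hlip h (hh.trans_le (min_le_left _ _)) s hs'
      have h1 := (hrem₂ s hs' (Z (z + h) s)
        (hl.trans_lt (hh.trans_le (min_le_right _ _)))).trans
        (mul_le_mul_of_nonneg_left hl (by positivity))
      have h2 := (g (Z z s) s).le_of_opNorm_le (hM s hs') (Z (z + h) s - Z z s - Y s h)
      have heq : f (Z (z + h) s) s - f (Z z s) s - g (Z z s) s (Y s h)
          = g (Z z s) s (Z (z + h) s - Z z s - Y s h)
            + (f (Z (z + h) s) s - f (Z z s) s - g (Z z s) s (Z (z + h) s - Z z s)) := by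
        rw [map_sub _ (Z (z + h) s - Z z s)]; abel
      rw [heq]
      exact (norm_add_le _ _).trans (add_le_add h2 h1)) t ht
  refine hgr.trans ?_
  rw [gronwallBound_of_K_ne_0 hM0.ne']
  simp only [zero_mul, zero_add, sub_zero]
  have he : Real.exp (M * t) - 1 ≤ Real.exp (M * S) := by
    have : Real.exp (M * t) ≤ Real.exp (M * S) := by gcongr; exact ht.2
    linarith
  calc c / D * (‖h‖ * L) / M * (Real.exp (M * t) - 1)
      ≤ c / D * (‖h‖ * L) / M * Real.exp (M * S) := by gcongr
    _ = c / D * D * ‖h‖ := by rw [hD]; ring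
    _ = c * ‖h‖ := by rw [div_mul_cancel₀ _ hD0.ne']

/-- The partial derivative in space of a function differentiable on a time strip. -/
theorem hasFDerivAt_slice {E G : Type*} [NormedAddCommGroup E] [NormedSpace ℝ E]
    [NormedAddCommGroup G] [NormedSpace ℝ G] {f : E → ℝ → G} {I : Set ℝ} {x : E} {s : ℝ}
    {f' : E × ℝ →L[ℝ] G} (hs : s ∈ I)
    (hf : HasFDerivWithinAt (fun p : E × ℝ => f p.1 p.2) f' (univ ×ˢ I) (x, s)) :
    HasFDerivAt (fun x => f x s) (f' ∘L ContinuousLinearMap.inl ℝ E ℝ) x := by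
  rw [← hasFDerivWithinAt_univ]
  have hmaps : MapsTo (fun y : E => (y, s)) univ (univ ×ˢ I) := fun y _ => ⟨mem_univ _, hs⟩
  exact HasFDerivWithinAt.comp (g := fun p : E × ℝ => f p.1 p.2) x hf
    (hasFDerivAt_prodMk_left x s).hasFDerivWithinAt hmaps

/-- **The continuous averaging equation (Lie method derivation).**
If the change of variables `z ↦ Z(z,s)`, obtained as the shift along solutions of
`dZ/ds = f(Z,s)`, `Z(z,0) = z`, transforms the system `ż = uhat(z)` into `ż = u(z,s)`
(i.e. `u(Z(z,s),s) = D_z Z(z,s)(uhat(z))`), then `u(·,0) = uhat` and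
`∂u/∂s = [u,f]` along the flow, where `[v,w] = Dw·v − Dv·w`. -/
theorem continuous_averaging_equation
    {E : Type*} [NormedAddCommGroup E] [NormedSpace ℝ E] [FiniteDimensional ℝ E]
    (S : ℝ) (hS : 0 < S)
    (f : E → ℝ → E)
    (hf : ContDiffOn ℝ 2 (fun p : E × ℝ => f p.1 p.2) (univ ×ˢ Icc 0 S))
    (Z : E → ℝ → E)
    (hZ0 : ∀ z : E, Z z 0 = z)
    (hZode : ∀ z : E, ∀ s ∈ Icc (0:ℝ) S,
      HasDerivWithinAt (fun s' => Z z s') (f (Z z s) s) (Icc 0 S) s)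
    (uhat : E → E) (huhat : ContDiff ℝ 1 uhat)
    (u : E → ℝ → E)
    (hu : ContDiffOn ℝ 1 (fun p : E × ℝ => u p.1 p.2) (univ ×ˢ Icc 0 S))
    (htransform : ∀ z : E, ∀ s ∈ Icc (0:ℝ) S,
      u (Z z s) s = fderiv ℝ (fun z' => Z z' s) z (uhat z)) :
    (∀ z : E, u z 0 = uhat z) ∧
    (∀ z : E, ∀ s ∈ Icc (0:ℝ) S,
      derivWithin (fun s' => u (Z z s) s') (Icc 0 S) s
        = fderiv ℝ (fun x => f x s) (Z z s) (u (Z z s) s)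
          - fderiv ℝ (fun x => u x s) (Z z s) (f (Z z s) s)) := by
  have : CompleteSpace E := FiniteDimensional.complete ℝ E
  have hI : UniqueDiffOn ℝ (Icc 0 S) := uniqueDiffOn_Icc hS
  have hD : UniqueDiffOn ℝ ((univ : Set E) ×ˢ Icc 0 S) := uniqueDiffOn_univ.prod hI
  refine ⟨fun z => ?_, fun z s hs => ?_⟩
  · have h := htransform z 0 (left_mem_Icc.2 hS.le)
    simpa [hZ0] using h
  set f' := fderivWithin ℝ (fun p : E × ℝ => f p.1 p.2) (univ ×ˢ Icc 0 S) with hf'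
  have hfg : ∀ x, ∀ s ∈ Icc 0 S, HasFDerivAt (fun x => f x s)
      (f' (x, s) ∘L ContinuousLinearMap.inl ℝ E ℝ) x := fun x s hs =>
    hasFDerivAt_slice hs
      ((hf.differentiableOn two_ne_zero) (x, s) ⟨mem_univ _, hs⟩).hasFDerivWithinAt
  have hg : ContinuousOn (fun p : E × ℝ => f' (p.1, p.2) ∘L ContinuousLinearMap.inl ℝ E ℝ)
      (univ ×ˢ Icc 0 S) :=
    (hf.continuousOn_fderivWithin hD one_le_two).clm_comp continuousOn_const
  obtain ⟨Y, hY⟩ := exists_hasFDerivAt_flow hS.le hfg hg hZ0 hZode z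
  have huY : ∀ t ∈ Icc 0 S, u (Z z t) t = Y t (uhat z) := fun t ht => by
    rw [htransform z t ht, (hY t ht).1.fderiv]
  have hU := ((hu.differentiableOn one_ne_zero) (Z z s, s) ⟨mem_univ _, hs⟩).hasFDerivWithinAt
  set U' := fderivWithin ℝ (fun p : E × ℝ => u p.1 p.2) (univ ×ˢ Icc 0 S) (Z z s, s)
  have htime : HasDerivWithinAt (fun s' => u (Z z s) s') (U' (0, 1)) (Icc 0 S) s :=
    hU.comp_hasDerivWithinAt_of_eq s
      ((hasDerivWithinAt_const s (Icc 0 S) (Z z s)).prodMk (hasDerivWithinAt_id s _))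
      (fun t ht => ⟨mem_univ _, ht⟩) rfl
  have hflow : HasDerivWithinAt (fun s' => u (Z z s') s') (U' (f (Z z s) s, 1)) (Icc 0 S) s :=
    hU.comp_hasDerivWithinAt_of_eq s
      ((hZode z s hs).prodMk (hasDerivWithinAt_id s _))
      (fun t ht => ⟨mem_univ _, ht⟩) rfl
  have hvar : HasDerivWithinAt (fun s' => u (Z z s') s')
      ((f' (Z z s, s) ∘L ContinuousLinearMap.inl ℝ E ℝ) (Y s (uhat z))) (Icc 0 S) s :=
    ((ContinuousLinearMap.apply ℝ E (uhat z)).hasFDerivAt.comp_hasDerivWithinAt s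
      (hY s hs).2).congr huY (huY s hs)
  have hkey := (hI s hs).eq_deriv _ hflow hvar
  have hsplit : U' (f (Z z s) s, 1) = U' (f (Z z s) s, 0) + U' (0, 1) := by
    rw [← map_add]; simp
  rw [htime.derivWithin (hI s hs), (hfg _ s hs).fderiv, (hasFDerivAt_slice hs hU).fderiv,
    huY s hs, ← hkey, hsplit]
  simp
end

section
/- Let U ⊆ ℂ^m be open, ε ∈ ℝ, S > 0, and fix constants q > 0, C > 0. For each k ∈ ℤ let u^k : U × [0,S) → ℂ^m be holomorphic in z and C¹ in s, with the suprema over U × [0,S) of ‖u^k‖, ‖∂_z u^k‖ and ‖∂_s u^k‖ all bounded by C e^{−q|k|}. Define u(z,t,s) = Σ_{k∈ℤ} u^k(z,s) e^{ikt} and (ξu)(z,t,s) = Σ_{k∈ℤ} i·sign(k)·u^k(z,s) e^{ikt}. Then u satisfies the continuous averaging equation ∂_s u = ∂_t(ξu) − ε[ξu, u] on U × ℝ × [0,S) (the Lie bracket taken in the z variable) if and only if for every k ∈ ℤ and all (z,s) ∈ U × [0,S): ∂_s u^k = −|k| u^k + iε·sign(k)·[u^0, u^k] − 2iε Σ_{l+m=k,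 m<0<l} [u^l, u^m]. -/
open Set Function Complex

section AveragingLemmas

variable {E : Type*} [NormedAddCommGroup E] [NormedSpace ℂ E]

theorem summable_int_abs_pow_mul_exp (n : ℕ) {q : ℝ} (hq : 0 < q) :
    Summable fun k : ℤ => ((|k| : ℤ) : ℝ) ^ n * Real.exp (-q * ((|k| : ℤ) : ℝ)) := by
  have h := Real.summable_pow_mul_exp_neg_nat_mul n hq
  refine Summable.of_nat_of_neg ?_ ?_
  · simpa using h
  · simpa using h

theorem norm_exp_I_mul_int (k : ℤ) (t : ℝ) : ‖Complex.exp (Complex.I * k * t)‖ = 1 := by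
  rw [show Complex.I * k * t = ((k * t : ℝ) : ℂ) * Complex.I by push_cast; ring]
  exact Complex.norm_exp_ofReal_mul_I _

theorem norm_I_mul_sign_le (k : ℤ) : ‖Complex.I * (Int.sign k : ℂ)‖ ≤ 1 := by
  rcases lt_trichotomy k 0 with h | h | h
  · simp [Int.sign_eq_neg_one_of_neg h]
  · simp [h]
  · simp [Int.sign_eq_one_of_pos h]

theorem exp_I_mul_int_add (k l : ℤ) (t : ℝ) :
    Complex.exp (Complex.I * (k - l : ℤ) * t) * Complex.exp (Complex.I * l * t)
      = Complex.exp (Complex.I * k * t) := by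
  rw [← Complex.exp_add]
  push_cast
  congr 1
  ring

variable [CompleteSpace E]

/-- A termwise derivative of a dominated series of functions on a convex set of reals. -/
theorem hasDerivWithinAt_tsum_of_convex {ι F : Type*} [NormedAddCommGroup F] [NormedSpace ℝ F]
    [CompleteSpace F] {s : Set ℝ} (hs : Convex ℝ s) {f f' : ι → ℝ → F} {b : ι → ℝ}
    (hb : Summable b) (hf : ∀ i, ∀ x ∈ s, HasDerivWithinAt (f i) (f' i x) s x)
    (hf' : ∀ i, ∀ x ∈ s, ‖f' i x‖ ≤ b i) (hsum : ∀ x ∈ s, Summable fun i => f i x)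
    {x : ℝ} (hx : x ∈ s) :
    HasDerivWithinAt (fun y => ∑' i, f i y) (∑' i, f' i x) s x := by
  rw [hasDerivWithinAt_iff_tendsto_slope]
  have key : Filter.Tendsto (fun y => ∑' i, slope (f i) x y) (nhdsWithin x (s \ {x}))
      (nhds (∑' i, f' i x)) := by
    refine tendsto_tsum_of_dominated_convergence hb
      (fun i => hasDerivWithinAt_iff_tendsto_slope.1 (hf i x hx)) ?_
    filter_upwards [self_mem_nhdsWithin] with y hy i
    have h := Convex.norm_image_sub_le_of_norm_hasDerivWithin_le (hf i) (hf' i) hs hx hy.1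
    have hpos : 0 < ‖y - x‖ := norm_pos_iff.2 (sub_ne_zero.2 hy.2)
    rw [slope_def_module, norm_smul, norm_inv, inv_mul_le_iff₀ hpos, mul_comm]
    exact h
  refine key.congr' ?_
  filter_upwards [self_mem_nhdsWithin] with y hy
  simp only [slope_def_module]
  rw [← (hsum y hy.1).tsum_sub (hsum x hx), tsum_const_smul'']

/-- An absolutely convergent Fourier series that vanishes identically has zero coefficients. -/
theorem fourier_coeff_eq_zero {d : ℤ → E} (hd : Summable fun k => ‖d k‖)
    (h : ∀ t : ℝ, ∑' k : ℤ, Complex.exp (Complex.I * k * t) • d k = 0) (n : ℤ) : d n = 0 := by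
  have hcont : ∀ k : ℤ, Continuous fun t : ℝ => Complex.exp (Complex.I * k * t) := by
    intro k; fun_prop
  have h1 : ∀ t : ℝ, HasSum (fun k : ℤ => Complex.exp (Complex.I * (k - n : ℤ) * t) • d k) 0 := by
    intro t
    have hs : Summable fun k : ℤ => Complex.exp (Complex.I * k * t) • d k :=
      Summable.of_norm (by simpa [norm_smul, norm_exp_I_mul_int] using hd)
    have h2 := (h t ▸ hs.hasSum).const_smul (Complex.exp (Complex.I * (-n : ℤ) * t))
    rw [smul_zero] at h2
    convert h2 using 2 with k
    rw [smul_smul, ← Complex.exp_add]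
    congr 2
    push_cast
    ring
  have h2 := intervalIntegral.hasSum_integral_of_dominated_convergence (μ := MeasureTheory.volume)
    (a := 0) (b := 2 * Real.pi)
    (F := fun (k : ℤ) (t : ℝ) => Complex.exp (Complex.I * (k - n : ℤ) * t) • d k)
    (f := fun _ => 0) (fun k _ => ‖d k‖)
    (fun k => ((hcont (k - n)).smul continuous_const).aestronglyMeasurable)
    (fun k => by
      filter_upwards with t _
      rw [norm_smul, norm_exp_I_mul_int, one_mul])
    (by filter_upwards with t _ using hd)
    (by simp)
    (by filter_upwards with t _ using h1 t)
  have h3 : ∀ k : ℤ, k ≠ n →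
      ∫ t in (0 : ℝ)..(2 * Real.pi), Complex.exp (Complex.I * (k - n : ℤ) * t) • d k = 0 := by
    intro k hk
    have hne : (Complex.I * (k - n : ℤ) : ℂ) ≠ 0 :=
      mul_ne_zero Complex.I_ne_zero (by exact_mod_cast sub_ne_zero.2 hk)
    rw [intervalIntegral.integral_smul_const, integral_exp_mul_complex hne]
    have : Complex.exp (Complex.I * (k - n : ℤ) * ((2 * Real.pi : ℝ) : ℂ)) = 1 := by
      rw [Complex.exp_eq_one_iff]
      exact ⟨k - n, by push_cast; ring⟩
    rw [this]
    simp
  have h4 := h2.unique (hasSum_single n h3)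
  simp only [intervalIntegral.integral_zero, sub_self, Int.cast_zero, mul_zero, zero_mul,
    Complex.exp_zero, one_smul, intervalIntegral.integral_const, sub_zero] at h4
  exact (smul_eq_zero.1 h4.symm).resolve_left (by positivity)

/-- The termwise Fréchet derivative of a dominated series. -/
theorem hasFDerivAt_tsum_smul {ι F G : Type*} [NormedAddCommGroup F] [NormedSpace ℂ F]
    [NormedAddCommGroup G] [NormedSpace ℂ G] [CompleteSpace G]
    {U : Set F} (hU : IsOpen U) {f : ι → F → G} {b : ι → ℝ} (hb : Summable b)
    (hf : ∀ i, DifferentiableOn ℂ (f i) U) (hfb : ∀ i, ∀ z ∈ U, ‖f i z‖ ≤ b i)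
    (hf' : ∀ i, ∀ z ∈ U, ‖fderiv ℂ (f i) z‖ ≤ b i) {c : ι → ℂ} (hc : ∀ i, ‖c i‖ ≤ 1)
    {z : F} (hz : z ∈ U) :
    HasFDerivAt (fun x => ∑' i, c i • f i x) (∑' i, c i • fderiv ℂ (f i) z) z := by
  obtain ⟨r, hr, hball⟩ := Metric.isOpen_iff.1 hU z hz
  refine hasFDerivAt_tsum_of_isPreconnected (s := Metric.ball z r) (x₀ := z) (u := b)
    (f := fun i x => c i • f i x) (f' := fun i x => c i • fderiv ℂ (f i) x)
    hb Metric.isOpen_ball ?_ ?_ ?_ (Metric.mem_ball_self hr) ?_ (Metric.mem_ball_self hr)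
  · let _ : NormedSpace ℝ F := NormedSpace.restrictScalars ℝ ℂ F
    exact (convex_ball z r).isPreconnected
  · intro i x hx
    exact (((hf i).differentiableAt (hU.mem_nhds (hball hx))).hasFDerivAt).const_smul (c i)
  · intro i x hx
    rw [norm_smul]
    exact (mul_le_of_le_one_left (norm_nonneg _) (hc i)).trans (hf' i x (hball hx))
  · refine Summable.of_norm_bounded hb fun i => ?_
    rw [norm_smul]
    exact (mul_le_of_le_one_left (norm_nonneg _) (hc i)).trans (hfb i z hz)

/-- The Cauchy product of a series of operators and a series of vectors, indexed by `ℤ`. -/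
theorem hasSum_apply_convolution {A : ℤ → E →L[ℂ] E} {a : ℤ → E}
    (hA : Summable fun k => ‖A k‖) (ha : Summable fun k => ‖a k‖) :
    HasSum (fun k : ℤ => ∑' l : ℤ, A (k - l) (a l)) ((∑' k, A k) (∑' k, a k)) ∧
      ∀ k : ℤ, Summable fun l : ℤ => A (k - l) (a l) := by
  have hs : Summable fun p : ℤ × ℤ => A p.1 (a p.2) := by
    have h : Summable fun p : ℤ × ℤ => ‖A p.1‖ * ‖a p.2‖ :=
      hA.mul_of_nonneg ha (fun _ => norm_nonneg _) (fun _ => norm_nonneg _)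
    exact Summable.of_norm_bounded h fun p => (A p.1).le_opNorm _
  let e : ℤ × ℤ ≃ ℤ × ℤ :=
    { toFun := fun p => (p.1 - p.2, p.2)
      invFun := fun p => (p.1 + p.2, p.2)
      left_inv := fun p => by simp
      right_inv := fun p => by simp }
  have h1 : ∑' p : ℤ × ℤ, A p.1 (a p.2) = (∑' k, A k) (∑' k, a k) := by
    rw [hs.tsum_prod]
    have h2 := (ContinuousLinearMap.apply ℂ E (∑' k, a k)).hasSum hA.of_norm.hasSum
    simp only [ContinuousLinearMap.apply_apply] at h2
    rw [← h2.tsum_eq]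
    exact tsum_congr fun k => (((A k).hasSum ha.of_norm.hasSum).tsum_eq)
  have h3 : HasSum (fun p : ℤ × ℤ => A (p.1 - p.2) (a p.2)) ((∑' k, A k) (∑' k, a k)) := by
    rw [← h1]
    exact (e.hasSum_iff (f := fun p : ℤ × ℤ => A p.1 (a p.2))).2 hs.hasSum
  have h4 : ∀ k : ℤ, Summable fun l : ℤ => A (k - l) (a l) := h3.summable.prod_factor
  exact ⟨h3.prod_fiberwise fun k => (h4 k).hasSum, h4⟩

/-- The Fourier modes of the Lie bracket of the Hilbert transform of a series with the series. -/
theorem hasSum_bracket_hilbert {A : ℤ → E →L[ℂ] E} {a : ℤ → E}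
    (hA : Summable fun k => ‖A k‖) (ha : Summable fun k => ‖a k‖) (t : ℝ) :
    HasSum (fun k : ℤ => Complex.exp (Complex.I * k * t) •
        ∑' l : ℤ, (Complex.I * (Int.sign l : ℂ)) • (A (k - l) (a l) - A l (a (k - l))))
      ((∑' k : ℤ, Complex.exp (Complex.I * k * t) • A k)
          (∑' k : ℤ, (Complex.I * (Int.sign k : ℂ)) • Complex.exp (Complex.I * k * t) • a k)
        - (∑' k : ℤ, (Complex.I * (Int.sign k : ℂ)) • Complex.exp (Complex.I * k * t) • A k)
          (∑' k : ℤ, Complex.exp (Complex.I * k * t) • a k)) := by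
  have hle : ∀ (k : ℤ) (x : ℝ), 0 ≤ x → ‖Complex.I * (Int.sign k : ℂ)‖ * x ≤ x :=
    fun k x hx => mul_le_of_le_one_left hx (norm_I_mul_sign_le k)
  have hA1 : Summable fun k : ℤ => ‖Complex.exp (Complex.I * k * t) • A k‖ := by
    simpa [norm_smul, norm_exp_I_mul_int] using hA
  have ha1 : Summable fun k : ℤ => ‖Complex.exp (Complex.I * k * t) • a k‖ := by
    simpa [norm_smul, norm_exp_I_mul_int] using ha
  have hA2 : Summable fun k : ℤ =>
      ‖(Complex.I * (Int.sign k : ℂ)) • Complex.exp (Complex.I * k * t) • A k‖ :=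
    Summable.of_nonneg_of_le (fun _ => norm_nonneg _)
      (fun k => by rw [norm_smul]; exact hle k _ (norm_nonneg _)) hA1
  have ha2 : Summable fun k : ℤ =>
      ‖(Complex.I * (Int.sign k : ℂ)) • Complex.exp (Complex.I * k * t) • a k‖ :=
    Summable.of_nonneg_of_le (fun _ => norm_nonneg _)
      (fun k => by rw [norm_smul]; exact hle k _ (norm_nonneg _)) ha1
  obtain ⟨h1, h1s⟩ := hasSum_apply_convolution hA1 ha2
  obtain ⟨h2, h2s⟩ := hasSum_apply_convolution hA2 ha1
  refine (h1.sub h2).congr_fun ?_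
  intro k
  have h3 := ((h1s k).hasSum.sub ((Equiv.subLeft k).hasSum_iff.2 (h2s k).hasSum)).tsum_eq
  rw [← h3, ← tsum_const_smul'']
  refine tsum_congr fun l => ?_
  have he := exp_I_mul_int_add k l t
  simp only [Function.comp, Equiv.subLeft_apply, sub_sub_cancel, smul_apply,
    map_smul, smul_smul, smul_sub]
  rw [← he]
  congr 2 <;> ring

/-- Folding a sign-weighted sum of a function antisymmetric under `l ↦ k - l`. -/
theorem tsum_sign_smul_of_antisymm {g : ℤ → E} (k : ℤ) (hg : Summable fun l => ‖g l‖)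
    (hanti : ∀ l, g (k - l) = -g l) :
    ∑' l : ℤ, (Int.sign l : ℂ) • g l
      = (2 : ℂ) • ∑' l : {l : ℤ // 0 < l ∧ k - l < 0}, g l - (Int.sign k : ℂ) • g 0 := by
  classical
  set P : ℤ → E := Set.indicator {l : ℤ | 0 < l ∧ k - l < 0} g with hP
  have hPs : Summable P := hg.of_norm.indicator _
  have hT : Summable fun l : ℤ => (Int.sign l : ℂ) • g l := by
    refine Summable.of_norm_bounded hg fun l => ?_
    rw [norm_smul]
    refine mul_le_of_le_one_left (norm_nonneg _) ?_
    simpa using norm_I_mul_sign_le l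
  have hsub : ∑' l : {l : ℤ // 0 < l ∧ k - l < 0}, g l = ∑' l, P l :=
    tsum_subtype {l : ℤ | 0 < l ∧ k - l < 0} g
  have h1 := hT.hasSum.add ((Equiv.subLeft k).hasSum_iff.2 hT.hasSum)
  have h2 := ((hPs.hasSum.add ((Equiv.subLeft k).hasSum_iff.2 hPs.hasSum)).const_smul (2 : ℂ)).add
    ((hasSum_ite_eq (0 : ℤ) (-((Int.sign k : ℂ) • g 0))).add
      (hasSum_ite_eq k (-((Int.sign k : ℂ) • g 0))))
  have hk : g k = -g 0 := by simpa using hanti 0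
  have h3 := h1.unique (h2.congr_fun ?_)
  · rw [hsub]
    have h4 : (2 : ℂ) • ∑' l : ℤ, (Int.sign l : ℂ) • g l
        = (2 : ℂ) • ((2 : ℂ) • ∑' l, P l - (Int.sign k : ℂ) • g 0) := by
      rw [two_smul ℂ (∑' l : ℤ, (Int.sign l : ℂ) • g l), h3]
      module
    exact smul_right_injective E two_ne_zero h4
  · intro l
    simp only [Function.comp, Equiv.subLeft_apply, hP, Set.indicator_apply, Set.mem_ofPred_eq,
      sub_sub_cancel, hanti]
    rcases eq_or_ne l 0 with rfl | hl0
    · rcases eq_or_ne k 0 with rfl | hk0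
      · simp
      · simp [hk0.symm]
    rcases eq_or_ne l k with rfl | hlk
    · simp [hl0, hk]
    rcases lt_or_gt_of_ne hl0 with h | h <;> rcases lt_or_gt_of_ne hlk with h' | h' <;>
      simp only [hl0, hlk, h, h', h.not_gt, h'.not_gt, sub_neg, sub_pos, Int.sign_eq_one_of_pos,
        Int.sign_eq_neg_one_of_neg, if_true, if_false, and_true, and_false, and_self] <;> push_cast <;> module

end AveragingLemmas

/-- **Fourier-mode form (ave1) of the continuous averaging system.**
With `u(z,t,s) = Σ_k u^k(z,s)e^{ikt}` and the Hilbert transform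
`(ξu)(z,t,s) = Σ_k i·sign(k)·u^k(z,s)e^{ikt}`, the continuous averaging equation
`∂_s u = ∂_t(ξu) − ε[ξu,u]` holds on `U × ℝ × [0,S)` if and only if for every `k`
`∂_s u^k = −|k|u^k + iε·sign(k)[u^0,u^k] − 2iε Σ_{l+m=k, m<0<l}[u^l,u^m]`,
where `[v,w](z) = Dw(z)·v(z) − Dv(z)·w(z)`. -/
theorem continuous_averaging_fourier_modes
    {m : ℕ} {U : Set (EuclideanSpace ℂ (Fin m))} (hU : IsOpen U)
    (ε : ℝ) (S : ℝ) (hS : 0 < S) (q C : ℝ) (hq : 0 < q) (hC : 0 < C)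
    (uk : ℤ → EuclideanSpace ℂ (Fin m) → ℝ → EuclideanSpace ℂ (Fin m))
    (dsuk : ℤ → EuclideanSpace ℂ (Fin m) → ℝ → EuclideanSpace ℂ (Fin m))
    -- each mode is holomorphic in `z` and C¹ in `s`
    (hhol : ∀ k : ℤ, ∀ s ∈ Ico (0:ℝ) S, DifferentiableOn ℂ (fun z => uk k z s) U)
    (hds : ∀ k : ℤ, ∀ z ∈ U, ∀ s ∈ Ico (0:ℝ) S,
      HasDerivWithinAt (fun s' => uk k z s') (dsuk k z s) (Ico 0 S) s)
    (hdscont : ∀ k : ℤ, ∀ z ∈ U, ContinuousOn (fun s => dsuk k z s) (Ico 0 S))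
    -- uniform exponential bounds on the modes and their derivatives
    (hbound : ∀ k : ℤ, ∀ z ∈ U, ∀ s ∈ Ico (0:ℝ) S,
      ‖uk k z s‖ ≤ C * Real.exp (-q * |k|))
    (hbound' : ∀ k : ℤ, ∀ z ∈ U, ∀ s ∈ Ico (0:ℝ) S,
      ‖fderiv ℂ (fun z' => uk k z' s) z‖ ≤ C * Real.exp (-q * |k|))
    (hbound'' : ∀ k : ℤ, ∀ z ∈ U, ∀ s ∈ Ico (0:ℝ) S,
      ‖dsuk k z s‖ ≤ C * Real.exp (-q * |k|))
    -- the Fourier series and its Hilbert transform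
    (u ξu : EuclideanSpace ℂ (Fin m) → ℝ → ℝ → EuclideanSpace ℂ (Fin m))
    (hu : ∀ z t s, u z t s = ∑' k : ℤ, Complex.exp (Complex.I * k * t) • uk k z s)
    (hξu : ∀ z t s, ξu z t s =
      ∑' k : ℤ, (Complex.I * (Int.sign k : ℂ)) • Complex.exp (Complex.I * k * t) • uk k z s) :
    -- the continuous averaging PDE  ∂ₛu = ∂ₜ(ξu) − ε[ξu,u]
    (∀ z ∈ U, ∀ t : ℝ, ∀ s ∈ Ico (0:ℝ) S,
      HasDerivWithinAt (fun s' => u z t s')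
        ( deriv (fun t' : ℝ => ξu z t' s) t
          - ε • (fderiv ℂ (fun x => u x t s) z (ξu z t s)
                 - fderiv ℂ (fun x => ξu x t s) z (u z t s)) )
        (Ico 0 S) s)
    ↔
    -- the Fourier-mode equations (ave1)
    (∀ k : ℤ, ∀ z ∈ U, ∀ s ∈ Ico (0:ℝ) S,
      dsuk k z s
        = (-(|k| : ℝ)) • uk k z s
          + (Complex.I * (ε : ℂ) * (Int.sign k : ℂ)) •
              (fderiv ℂ (fun x => uk k x s) z (uk 0 z s)
               - fderiv ℂ (fun x => uk 0 x s) z (uk k z s))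
          - (2 * Complex.I * (ε : ℂ)) •
              ∑' l : {l : ℤ // 0 < l ∧ k - l < 0},
                (fderiv ℂ (fun x => uk (k - (l : ℤ)) x s) z (uk (l : ℤ) z s)
                 - fderiv ℂ (fun x => uk (l : ℤ) x s) z (uk (k - (l : ℤ)) z s))) := by
  have hb0 : Summable fun k : ℤ => C * Real.exp (-q * ((|k| : ℤ) : ℝ)) := by
    simpa using (summable_int_abs_pow_mul_exp 0 hq).mul_left C
  have hb1 : Summable fun k : ℤ => ((|k| : ℤ) : ℝ) * (C * Real.exp (-q * ((|k| : ℤ) : ℝ))) := by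
    refine ((summable_int_abs_pow_mul_exp 1 hq).mul_left C).congr fun k => ?_
    ring
  have hds_u : ∀ z ∈ U, ∀ t : ℝ, ∀ s ∈ Ico (0:ℝ) S, HasDerivWithinAt (fun s' => u z t s')
      (∑' k : ℤ, Complex.exp (Complex.I * k * t) • dsuk k z s) (Ico 0 S) s := by
    intro z hz t s hs
    simp only [hu]
    refine hasDerivWithinAt_tsum_of_convex (convex_Ico 0 S)
      (f := fun (k : ℤ) s' => Complex.exp (Complex.I * k * t) • uk k z s')
      (f' := fun (k : ℤ) s' => Complex.exp (Complex.I * k * t) • dsuk k z s') hb0 ?_ ?_ ?_ hs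
    · intro k x hx
      exact (hds k z hz x hx).const_smul (Complex.exp (Complex.I * k * t))
    · intro k x hx
      rw [norm_smul, norm_exp_I_mul_int, one_mul]
      exact hbound'' k z hz x hx
    · intro x hx
      refine Summable.of_norm_bounded hb0 fun k => ?_
      rw [norm_smul, norm_exp_I_mul_int, one_mul]
      exact hbound k z hz x hx
  have hdt_ξu : ∀ z ∈ U, ∀ t : ℝ, ∀ s ∈ Ico (0:ℝ) S,
      HasSum (fun k : ℤ => Complex.exp (Complex.I * k * t) • ((-(|k| : ℝ)) • uk k z s))
        (deriv (fun t' : ℝ => ξu z t' s) t) := by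
    intro z hz t s hs
    have hn : ∀ (k : ℤ) (t : ℝ),
        ‖Complex.exp (Complex.I * k * t) • ((-(|k| : ℝ)) • uk k z s)‖
          ≤ ((|k| : ℤ) : ℝ) * (C * Real.exp (-q * ((|k| : ℤ) : ℝ))) := by
      intro k t
      rw [norm_smul, norm_exp_I_mul_int, one_mul, norm_smul, norm_neg, Real.norm_eq_abs, abs_abs,
        Int.cast_abs]
      exact mul_le_mul_of_nonneg_left (by simpa using hbound k z hz s hs) (abs_nonneg _)
    have hd : HasDerivAt (fun t' : ℝ => ξu z t' s)
        (∑' k : ℤ, Complex.exp (Complex.I * k * t) • ((-(|k| : ℝ)) • uk k z s)) t := by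
      simp only [hξu]
      refine hasDerivAt_tsum
        (g := fun (k : ℤ) (t' : ℝ) =>
          (Complex.I * (Int.sign k : ℂ)) • Complex.exp (Complex.I * k * t') • uk k z s)
        (g' := fun (k : ℤ) (t' : ℝ) =>
          Complex.exp (Complex.I * k * t') • ((-(|k| : ℝ)) • uk k z s))
        (y₀ := t) hb1 ?_ (fun k t => hn k t) ?_ t
      · intro k t
        have he : HasDerivAt (fun t' : ℝ => Complex.exp (Complex.I * k * t'))
            (Complex.exp (Complex.I * k * t) * (Complex.I * k * 1)) t :=
          (((Complex.ofRealCLM.hasDerivAt (x := t)).const_mul (Complex.I * (k : ℂ)))).cexp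
        refine ((he.smul_const (uk k z s)).const_smul
          (Complex.I * (Int.sign k : ℂ))).congr_deriv ?_
        have hk : (Int.sign k : ℂ) * (k : ℂ) = ((|(k : ℝ)| : ℝ) : ℂ) := by
          rw [← Int.cast_mul, Int.sign_mul_self_eq_abs, ← Int.cast_abs, Complex.ofReal_intCast]
        rw [← Complex.coe_smul (-|(k : ℝ)|), smul_smul, smul_smul, Complex.ofReal_neg, ← hk]
        congr 1
        linear_combination (Int.sign k : ℂ) * k * Complex.exp (Complex.I * k * t) * Complex.I_sq
      · refine Summable.of_norm_bounded hb0 fun k => ?_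
        rw [norm_smul, norm_smul, norm_exp_I_mul_int, one_mul]
        exact (mul_le_of_le_one_left (norm_nonneg _) (norm_I_mul_sign_le k)).trans
          (hbound k z hz s hs)
    rw [hd.deriv]
    exact (Summable.of_norm_bounded hb1 fun k => hn k t).hasSum
  have hbracket : ∀ z ∈ U, ∀ t : ℝ, ∀ s ∈ Ico (0:ℝ) S,
      HasSum (fun k : ℤ => Complex.exp (Complex.I * k * t) •
        ∑' l : ℤ, (Complex.I * (Int.sign l : ℂ)) •
          (fderiv ℂ (fun x => uk (k - l) x s) z (uk l z s)
            - fderiv ℂ (fun x => uk l x s) z (uk (k - l) z s)))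
        (fderiv ℂ (fun x => u x t s) z (ξu z t s)
          - fderiv ℂ (fun x => ξu x t s) z (u z t s)) := by
    intro z hz t s hs
    have hfu := hasFDerivAt_tsum_smul hU (f := fun (k : ℤ) x => uk k x s) hb0
      (fun k => hhol k s hs) (fun k x hx => hbound k x hx s hs)
      (fun k x hx => hbound' k x hx s hs) (c := fun k : ℤ => Complex.exp (Complex.I * k * t))
      (fun k => (norm_exp_I_mul_int k t).le) hz
    have hfξ := hasFDerivAt_tsum_smul hU (f := fun (k : ℤ) x => uk k x s) hb0
      (fun k => hhol k s hs) (fun k x hx => hbound k x hx s hs)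
      (fun k x hx => hbound' k x hx s hs)
      (c := fun k : ℤ => (Complex.I * (Int.sign k : ℂ)) * Complex.exp (Complex.I * k * t))
      (fun k => by
        rw [norm_mul, norm_exp_I_mul_int, mul_one]
        exact norm_I_mul_sign_le k) hz
    simp only [mul_smul (Complex.I * _)] at hfξ
    simp only [hu, hξu]
    rw [hfu.fderiv, hfξ.fderiv]
    exact hasSum_bracket_hilbert (A := fun k => fderiv ℂ (fun x => uk k x s) z)
      (a := fun k => uk k z s)
      (Summable.of_nonneg_of_le (fun _ => norm_nonneg _) (fun k => hbound' k z hz s hs) hb0)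
      (Summable.of_nonneg_of_le (fun _ => norm_nonneg _) (fun k => hbound k z hz s hs) hb0) t
  have hfold : ∀ k : ℤ, ∀ z ∈ U, ∀ s ∈ Ico (0:ℝ) S,
      (-(|k| : ℝ)) • uk k z s
          + (Complex.I * (ε : ℂ) * (Int.sign k : ℂ)) •
              (fderiv ℂ (fun x => uk k x s) z (uk 0 z s)
               - fderiv ℂ (fun x => uk 0 x s) z (uk k z s))
          - (2 * Complex.I * (ε : ℂ)) •
              ∑' l : {l : ℤ // 0 < l ∧ k - l < 0},
                (fderiv ℂ (fun x => uk (k - (l : ℤ)) x s) z (uk (l : ℤ) z s)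
                 - fderiv ℂ (fun x => uk (l : ℤ) x s) z (uk (k - (l : ℤ)) z s))
        = (-(|k| : ℝ)) • uk k z s - ε • ∑' l : ℤ, (Complex.I * (Int.sign l : ℂ)) •
          (fderiv ℂ (fun x => uk (k - l) x s) z (uk l z s)
            - fderiv ℂ (fun x => uk l x s) z (uk (k - l) z s)) := by
    intro k z hz s hs
    have hA : Summable fun k : ℤ => ‖fderiv ℂ (fun x => uk k x s) z‖ :=
      Summable.of_nonneg_of_le (fun _ => norm_nonneg _) (fun k => hbound' k z hz s hs) hb0
    have ha : Summable fun k : ℤ => ‖uk k z s‖ :=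
      Summable.of_nonneg_of_le (fun _ => norm_nonneg _) (fun k => hbound k z hz s hs) hb0
    have h1 := (hasSum_apply_convolution hA ha).2 k
    have h2 := (Equiv.subLeft k).summable_iff.2 h1
    have hg := h1.sub h2
    simp only [Function.comp, Equiv.subLeft_apply, sub_sub_cancel] at hg
    have h3 := tsum_sign_smul_of_antisymm k hg.norm (fun l => by simp)
    simp only [sub_zero] at h3
    simp only [mul_smul Complex.I]
    rw [tsum_const_smul'', h3, ← Complex.coe_smul ε]
    module
  have hrhs : ∀ z ∈ U, ∀ t : ℝ, ∀ s ∈ Ico (0:ℝ) S, HasSum (fun k : ℤ =>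
      Complex.exp (Complex.I * k * t) •
        ((-(|k| : ℝ)) • uk k z s - ε • ∑' l : ℤ, (Complex.I * (Int.sign l : ℂ)) •
          (fderiv ℂ (fun x => uk (k - l) x s) z (uk l z s)
            - fderiv ℂ (fun x => uk l x s) z (uk (k - l) z s))))
      (deriv (fun t' : ℝ => ξu z t' s) t
        - ε • (fderiv ℂ (fun x => u x t s) z (ξu z t s)
               - fderiv ℂ (fun x => ξu x t s) z (u z t s))) := by
    intro z hz t s hs
    refine ((hdt_ξu z hz t s hs).sub ((hbracket z hz t s hs).const_smul ε)).congr_fun fun k => ?_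
    rw [smul_sub, smul_comm ε]
  constructor
  · intro h k z hz s hs
    rw [hfold k z hz s hs, ← sub_eq_zero]
    have hds_sum : ∀ t : ℝ,
        Summable fun k : ℤ => Complex.exp (Complex.I * k * t) • dsuk k z s := by
      intro t
      refine Summable.of_norm_bounded hb0 fun k => ?_
      rw [norm_smul, norm_exp_I_mul_int, one_mul]
      exact hbound'' k z hz s hs
    refine fourier_coeff_eq_zero (d := fun k => dsuk k z s -
      ((-(|k| : ℝ)) • uk k z s - ε • ∑' l : ℤ, (Complex.I * (Int.sign l : ℂ)) •
          (fderiv ℂ (fun x => uk (k - l) x s) z (uk l z s)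
            - fderiv ℂ (fun x => uk l x s) z (uk (k - l) z s)))) ?_ ?_ k
    · have h0 := ((hds_sum 0).sub (hrhs z hz 0 s hs).summable).norm
      simpa using h0
    · intro t
      simp only [smul_sub (Complex.exp _) (dsuk _ z s)]
      rw [(hds_sum t).tsum_sub (hrhs z hz t s hs).summable, (hrhs z hz t s hs).tsum_eq, sub_eq_zero]
      exact UniqueDiffWithinAt.eq_deriv (Ico 0 S) (uniqueDiffOn_Ico 0 S s hs)
        (hds_u z hz t s hs) (h z hz t s hs)
  · intro h z hz t s hs
    refine (hds_u z hz t s hs).congr_deriv ?_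
    rw [← (hrhs z hz t s hs).tsum_eq]
    exact tsum_congr fun k => by rw [h k z hz s hs, hfold k z hz s hs]
end

section
/- Let U' ⊆ U ⊆ ℂ^m be open sets, let w : U → ℂ^m and v : U → ℂ^m be holomorphic vector fields, let ε ∈ ℝ, S > 0, let k ∈ ℤ∖{0} and σ = sign(k). Suppose h : [0,S) × U' → U is holomorphic in z, C¹ in s, and satisfies ∂_s h(s,z) = iεσ·w(h(s,z)), h(0,z) = z, with the ℂ-linear derivative D_z h(s,z) invertible for all (s,z). Define u(z,s) = e^{−|k|s}·(D_z h(s,z))^{−1}(v(h(s,z))), the rescaled pullback of v along the complex-time flow of w. Then u(·,0) = v and for all (s,z) ∈ [0,S) × U': ∂_s u(z,s) = −|k|·u(z,s) + iεσ·[w, u(·,s)](z). -/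
open Set Function Complex

/-- **Cauchy's estimate** for the Fréchet derivative at the centre of a ball. -/
theorem norm_fderiv_le_of_forall_mem_ball {E F : Type*} [NormedAddCommGroup E] [NormedSpace ℂ E]
    [NormedAddCommGroup F] [NormedSpace ℂ F] {f : E → F} {c : E} {R C : ℝ} (hR : 0 < R)
    (hd : DifferentiableOn ℂ f (Metric.ball c R)) (hC : ∀ z ∈ Metric.ball c R, ‖f z‖ ≤ C) :
    ‖fderiv ℂ f c‖ ≤ 2 * C / R := by
  refine norm_fderiv_le_div_of_mapsTo_ball hd (fun z hz => ?_) hR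
  rw [Metric.mem_closedBall, dist_eq_norm]
  linarith [norm_sub_le (f z) (f c), hC z hz, hC c (Metric.mem_ball_self hR)]

section Smoothness

variable {E F : Type*} [NormedAddCommGroup E] [NormedSpace ℂ E] [FiniteDimensional ℂ E]
  [NormedAddCommGroup F] [NormedSpace ℂ F] [FiniteDimensional ℂ F]

/-- Directional derivatives of holomorphic maps of several variables are holomorphic. -/
theorem differentiableOn_fderiv_apply_const {f : E → F} {U : Set E} (hU : IsOpen U)
    (hf : DifferentiableOn ℂ f U) (e : E) : DifferentiableOn ℂ (fun z => fderiv ℂ f z e) U := by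
  intro z₀ hz₀
  apply DifferentiableAt.differentiableWithinAt
  have : ProperSpace E := FiniteDimensional.proper ℂ E
  have : ProperSpace (E →L[ℂ] F) := FiniteDimensional.proper ℂ _
  have : CompleteSpace F := FiniteDimensional.complete ℂ F
  borelize E
  borelize F
  borelize (E →L[ℂ] F)
  obtain ⟨δ, hδ, hball⟩ : ∃ δ > 0, ∀ z ∈ Metric.ball z₀ δ, z ∈ U ∧ ‖f z‖ ≤ ‖f z₀‖ + 1 := by
    refine Metric.eventually_nhds_iff_ball.1 (Filter.Eventually.and (hU.mem_nhds hz₀) ?_)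
    filter_upwards [(hf.continuousOn.continuousAt (hU.mem_nhds hz₀)).norm.eventually_lt
      continuousAt_const (lt_add_one _)] with z hz using hz.le
  set ρ := δ / 3 with hρ
  have hρ0 : 0 < ρ := by positivity
  set C := ‖f z₀‖ + 1
  have hfδ : DifferentiableOn ℂ f (Metric.ball z₀ δ) := hf.mono fun z hz => (hball z hz).1
  have hbound : ∀ z ∈ Metric.ball z₀ (2 * ρ), ‖fderiv ℂ f z‖ ≤ 2 * C / ρ := by
    intro z hz
    have hsub : Metric.ball z ρ ⊆ Metric.ball z₀ δ :=
      Metric.ball_subset_ball' (by rw [Metric.mem_ball] at hz; linarith)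
    exact norm_fderiv_le_of_forall_mem_ball hρ0 (hfδ.mono hsub) fun y hy => (hball y (hsub hy)).2
  set r := ρ / (‖e‖ + 1) with hr
  have hr0 : 0 < r := by positivity
  have hre : r * ‖e‖ < ρ := by
    rw [hr, div_mul_eq_mul_div, div_lt_iff₀ (by positivity)]
    nlinarith
  have hmem : ∀ z ∈ Metric.ball z₀ ρ, ∀ ζ : ℂ, ‖ζ‖ ≤ r → z + ζ • e ∈ Metric.ball z₀ (2 * ρ) := by
    intro z hz ζ hζ
    rw [Metric.mem_ball, dist_eq_norm] at hz ⊢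
    calc ‖z + ζ • e - z₀‖ = ‖(z - z₀) + ζ • e‖ := by congr 1; abel
      _ ≤ ‖z - z₀‖ + ‖ζ‖ * ‖e‖ := (norm_add_le _ _).trans_eq (by rw [norm_smul])
      _ < 2 * ρ := by nlinarith [mul_le_mul_of_nonneg_right hζ (norm_nonneg e)]
  have hsub : Metric.ball z₀ (2 * ρ) ⊆ Metric.ball z₀ δ := Metric.ball_subset_ball (by linarith)
  have hcm : ∀ θ : ℝ, ‖circleMap 0 r θ‖ ≤ r := fun θ => by simp [abs_of_pos hr0]
  set a : ℝ → ℂ := fun θ => deriv (circleMap 0 r) θ * ((circleMap 0 r θ - 0) ^ 2)⁻¹ with ha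
  have hac : Continuous a := by
    have h0 : ∀ θ, circleMap 0 r θ ≠ 0 := fun θ => circleMap_ne_center hr0.ne'
    simp only [ha, deriv_circleMap, sub_zero]
    exact ((continuous_circleMap 0 r).mul continuous_const).mul
      (((continuous_circleMap 0 r).pow 2).inv₀ fun θ => pow_ne_zero 2 (h0 θ))
  have hformula : ∀ z ∈ Metric.ball z₀ ρ, fderiv ℂ f z e = (2 * Real.pi * I : ℂ)⁻¹ •
      ∫ θ in (0 : ℝ)..2 * Real.pi, a θ • f (z + circleMap 0 r θ • e) := by
    intro z hz
    have hline : ∀ ζ : ℂ, HasDerivAt (fun ζ : ℂ => z + ζ • e) e ζ := fun ζ => by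
      simpa using ((hasDerivAt_id ζ).smul_const e).const_add z
    set V : Set ℂ := (fun ζ : ℂ => z + ζ • e) ⁻¹' Metric.ball z₀ δ with hV
    have hVo : IsOpen V := Metric.isOpen_ball.preimage (by fun_prop)
    have hd : DifferentiableOn ℂ (fun ζ : ℂ => f (z + ζ • e)) V :=
      hfδ.comp (fun ζ _ => (hline ζ).differentiableAt.differentiableWithinAt) fun ζ hζ => hζ
    have hcb : Metric.closedBall (0 : ℂ) r ⊆ V := fun ζ hζ =>
      hsub (hmem z hz ζ (by simpa using hζ))
    have hfz : HasFDerivAt f (fderiv ℂ f z) (z + (0 : ℂ) • e) := by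
      rw [zero_smul, add_zero]
      exact (hfδ.differentiableAt (Metric.isOpen_ball.mem_nhds (Metric.ball_subset_ball
        (by linarith) hz))).hasFDerivAt
    rw [← (hfz.comp_hasDerivAt (0 : ℂ) (hline 0)).deriv]
    change deriv (fun ζ : ℂ => f (z + ζ • e)) 0 = _
    rw [← two_pi_I_inv_smul_circleIntegral_sub_sq_inv_smul_of_differentiable hVo hcb hd
      (Metric.mem_ball_self hr0), circleIntegral]
    simp only [ha, smul_smul]
  have hcont : ∀ z ∈ Metric.ball z₀ ρ,
      Continuous fun θ : ℝ => a θ • f (z + circleMap 0 r θ • e) := by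
    intro z hz
    refine hac.smul (hfδ.continuousOn.comp_continuous ?_ fun θ => hsub (hmem z hz _ (hcm θ)))
    exact continuous_const.add ((continuous_circleMap 0 r).smul continuous_const)
  have hint : HasFDerivAt (fun z => ∫ θ in (0 : ℝ)..2 * Real.pi, a θ • f (z + circleMap 0 r θ • e))
      (∫ θ in (0 : ℝ)..2 * Real.pi, a θ • fderiv ℂ f (z₀ + circleMap 0 r θ • e)) z₀ := by
    refine intervalIntegral.hasFDerivAt_integral_of_dominated_of_fderiv_le
      (bound := fun θ => ‖a θ‖ * (2 * C / ρ))
      (F' := fun z θ => a θ • fderiv ℂ f (z + circleMap 0 r θ • e))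
      (Metric.ball_mem_nhds z₀ hρ0) ?_ ?_ ?_ ?_ ?_ ?_
    · filter_upwards [Metric.ball_mem_nhds z₀ hρ0] with z hz
        using (hcont z hz).aestronglyMeasurable
    · exact (hcont z₀ (Metric.mem_ball_self hρ0)).intervalIntegrable _ _
    · refine hac.aestronglyMeasurable.smul (Measurable.aestronglyMeasurable ?_)
      refine (measurable_fderiv ℂ f).comp (Continuous.measurable ?_)
      exact continuous_const.add ((continuous_circleMap 0 r).smul continuous_const)
    · refine .of_forall fun θ _ z hz => ?_
      rw [norm_smul]
      exact mul_le_mul_of_nonneg_left (hbound _ (hmem z hz _ (hcm θ))) (norm_nonneg _)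
    · exact (hac.norm.mul continuous_const).intervalIntegrable _ _
    · refine .of_forall fun θ _ z hz => ?_
      have hfz := (hfδ.differentiableAt (Metric.isOpen_ball.mem_nhds
        (hsub (hmem z hz _ (hcm θ))))).hasFDerivAt
      exact ((hasFDerivAt_comp_add_right _).2 hfz).const_smul (a θ)
  refine (hint.differentiableAt.const_smul (2 * Real.pi * I : ℂ)⁻¹).congr_of_eventuallyEq ?_
  filter_upwards [Metric.ball_mem_nhds z₀ hρ0] with z hz using hformula z hz

/-- Holomorphic maps of several variables are smooth. -/
theorem contDiffOn_of_differentiableOn_complex {f : E → F} {U : Set E} (hU : IsOpen U)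
    (hf : DifferentiableOn ℂ f U) (n : ℕ) : ContDiffOn ℂ n f U := by
  induction n generalizing f with
  | zero => exact contDiffOn_zero.2 hf.continuousOn
  | succ n ih =>
    rw [Nat.cast_succ, contDiffOn_succ_iff_fderiv_of_isOpen hU]
    exact ⟨hf, by simp, contDiffOn_clm_apply.2 fun e => ih (differentiableOn_fderiv_apply_const hU hf e)⟩

end Smoothness

/-- The pullback along the flow at time zero is trivial. -/
theorem pullback_flow_zero {E : Type*} [NormedAddCommGroup E] [NormedSpace ℂ E] {U' : Set E}
    {v : E → E} {h : ℝ → E → E} (hU' : IsOpen U') (hinit : ∀ z ∈ U', h 0 z = z) {z : E}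
    (hz : z ∈ U') :
    VectorField.pullback ℂ (h 0) v z = v z := by
  have hid : fderiv ℂ (h 0) z = .id ℂ E := by
    rw [Filter.EventuallyEq.fderiv_eq (f := id), fderiv_id]
    filter_upwards [hU'.mem_nhds hz] with y hy using hinit y hy
  rw [VectorField.pullback, hid, ContinuousLinearMap.inverse_id, hinit z hz,
    ContinuousLinearMap.id_apply]

section Flow

variable {E : Type*} [NormedAddCommGroup E] [NormedSpace ℂ E] [FiniteDimensional ℂ E]
  {U U' : Set E} {X v : E → E} {S : ℝ} {h : ℝ → E → E}

/-- Trajectories of a holomorphic field starting near a given point stay in a common compact set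
up to any time strictly before the end of their common life span. -/
theorem exists_isCompact_forall_flow_mem (hU' : IsOpen U') (hU : IsOpen U)
    (hX : DifferentiableOn ℂ X U) (hmaps : ∀ s ∈ Ico 0 S, ∀ z ∈ U', h s z ∈ U)
    (hode : ∀ s ∈ Ico 0 S, ∀ z ∈ U', HasDerivWithinAt (fun t => h t z) (X (h s z)) (Ico 0 S) s)
    (hinit : ∀ z ∈ U', h 0 z = z) {z₀ : E} (hz₀ : z₀ ∈ U') {T : ℝ} (hT : T < S) :
    ∃ r > 0, ∃ K, IsCompact K ∧ K ⊆ U ∧ Metric.ball z₀ r ⊆ U' ∧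
      ∀ z ∈ Metric.ball z₀ r, ∀ t ∈ Icc 0 T, h t z ∈ K := by
  have : ProperSpace E := FiniteDimensional.proper ℂ E
  have hTS : Icc 0 T ⊆ Ico 0 S := Icc_subset_Ico_right hT
  have hcont : ∀ z ∈ U', ContinuousOn (fun t => h t z) (Icc 0 T) := fun z hz t ht =>
    (hode t (hTS ht) z hz).continuousWithinAt.mono hTS
  have hderiv : ∀ z ∈ U', ∀ t ∈ Ico 0 S,
      HasDerivWithinAt (fun t => h t z) (X (h t z)) (Ici t) t := fun z hz t ht =>
    (hode t ht z hz).mono_of_mem_nhdsWithin (Ico_mem_nhdsGE_of_mem ht)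
  have hK₀ : IsCompact ((fun t => h t z₀) '' Icc 0 T) := isCompact_Icc.image_of_continuousOn
    (hcont z₀ hz₀)
  obtain ⟨δ, hδ, hδU⟩ := hK₀.exists_cthickening_subset_open hU
    (image_subset_iff.2 fun t ht => hmaps t (hTS ht) z₀ hz₀)
  have hK : IsCompact (Metric.cthickening δ ((fun t => h t z₀) '' Icc 0 T)) := hK₀.cthickening
  set K := Metric.cthickening δ ((fun t => h t z₀) '' Icc 0 T)
  have hballK : ∀ t ∈ Icc 0 T, Metric.ball (h t z₀) δ ⊆ K := fun t ht =>
    Metric.ball_subset_closedBall.trans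
      (Metric.closedBall_subset_cthickening (mem_image_of_mem (fun t => h t z₀) ht) δ)
  have hX1 : ContDiffOn ℂ 1 X U := mod_cast contDiffOn_of_differentiableOn_complex hU hX 1
  obtain ⟨L, hL⟩ := hK.exists_bound_of_continuousOn
    ((hX1.continuousOn_fderiv_of_isOpen hU le_rfl).mono hδU)
  have hLip : ∀ t ∈ Icc 0 T, LipschitzOnWith L.toNNReal X (Metric.ball (h t z₀) δ) := by
    intro t ht
    refine Convex.lipschitzOnWith_of_nnnorm_fderiv_le (𝕜 := ℂ)
      (fun x hx => hX.differentiableAt (hU.mem_nhds (hδU (hballK t ht hx))))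
      (fun x hx => ?_) (convex_ball _ _)
    rw [← NNReal.coe_le_coe, coe_nnnorm]
    exact (hL x (hballK t ht hx)).trans (Real.le_coe_toNNReal L)
  obtain ⟨r₀, hr₀, hr₀U'⟩ := Metric.isOpen_iff.1 hU' z₀ hz₀
  refine ⟨min r₀ (δ * Real.exp (-(L.toNNReal * T))), by positivity, K, hK, hδU,
    (Metric.ball_subset_ball (min_le_left _ _)).trans hr₀U', fun z hz => ?_⟩
  have hzU' : z ∈ U' := hr₀U' (Metric.ball_subset_ball (min_le_left _ _) hz)
  have hzr : dist z₀ z < δ * Real.exp (-(L.toNNReal * T)) := by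
    rw [dist_comm]
    exact (Metric.mem_ball.1 hz).trans_le (min_le_right _ _)
  suffices H : ∀ t ∈ Icc 0 T, dist (h t z₀) (h t z) < δ from fun t ht =>
    hballK t ht (by rw [Metric.mem_ball, dist_comm]; exact H t ht)
  by_contra! H
  have hclosed : IsClosed {t ∈ Icc 0 T | δ ≤ dist (h t z₀) (h t z)} :=
    ((continuous_dist.comp_continuousOn
      ((hcont z₀ hz₀).prodMk (hcont z hzU'))).preimage_isClosed_of_isClosed isClosed_Icc
      isClosed_Ici)
  obtain ⟨τ, ⟨hτ, hτδ⟩, hτmin⟩ :=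
    (isCompact_Icc.of_isClosed_subset hclosed (sep_subset _ _)).exists_isLeast H
  have hIcc : Icc 0 τ ⊆ Icc 0 T := Icc_subset_Icc_right hτ.2
  have hlt : ∀ t ∈ Ico 0 τ, dist (h t z₀) (h t z) < δ := fun t ht => by
    by_contra! hge
    exact (hτmin ⟨hIcc (Ico_subset_Icc_self ht), hge⟩).not_gt ht.2
  have hgron := dist_le_of_trajectories_ODE_of_mem (v := fun _ => X)
    (s := fun t => Metric.ball (h t z₀) δ) (f := fun t => h t z₀) (g := fun t => h t z)
    (fun t ht => hLip t (hIcc (Ico_subset_Icc_self ht)))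
    ((hcont z₀ hz₀).mono hIcc)
    (fun t ht => hderiv z₀ hz₀ t (hTS (hIcc (Ico_subset_Icc_self ht))))
    (fun t _ => Metric.mem_ball_self hδ)
    ((hcont z hzU').mono hIcc)
    (fun t ht => hderiv z hzU' t (hTS (hIcc (Ico_subset_Icc_self ht))))
    (fun t ht => by rw [Metric.mem_ball, dist_comm]; exact hlt t ht)
    le_rfl τ ⟨hτ.1, le_rfl⟩
  rw [hinit z₀ hz₀, hinit z hzU', sub_zero] at hgron
  refine (hτδ.trans hgron).not_gt ?_
  calc dist z₀ z * Real.exp (L.toNNReal * τ) ≤ dist z₀ z * Real.exp (L.toNNReal * T) := by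
        have := hτ.2
        gcongr
    _ < δ * Real.exp (-(L.toNNReal * T)) * Real.exp (L.toNNReal * T) := by gcongr
    _ = δ := by rw [mul_assoc, ← Real.exp_add, neg_add_cancel, Real.exp_zero, mul_one]

/-- **Variational equation**: the spatial derivative of the flow of a holomorphic field solves the
linearized equation along the trajectory. -/
theorem hasDerivWithinAt_fderiv_flow (hU' : IsOpen U') (hU : IsOpen U)
    (hX : DifferentiableOn ℂ X U) (hmaps : ∀ s ∈ Ico 0 S, ∀ z ∈ U', h s z ∈ U)
    (hhol : ∀ s ∈ Ico 0 S, DifferentiableOn ℂ (h s) U')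
    (hode : ∀ s ∈ Ico 0 S, ∀ z ∈ U', HasDerivWithinAt (fun t => h t z) (X (h s z)) (Ico 0 S) s)
    (hinit : ∀ z ∈ U', h 0 z = z) {s : ℝ} (hs : s ∈ Ico 0 S) {z₀ : E} (hz₀ : z₀ ∈ U') :
    HasDerivWithinAt (fun t => fderiv ℂ (h t) z₀)
      (fderiv ℂ X (h s z₀) ∘L fderiv ℂ (h s) z₀) (Ico 0 S) s := by
  obtain ⟨T, hsT, hTS⟩ := exists_between hs.2
  obtain ⟨r, hr, K, hK, hKU, hrU', hmem⟩ :=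
    exists_isCompact_forall_flow_mem hU' hU hX hmaps hode hinit hz₀ hTS
  have hIcc : Icc 0 T ⊆ Ico 0 S := Icc_subset_Ico_right hTS
  have hsT' : s ∈ Icc 0 T := ⟨hs.1, hsT.le⟩
  have hX1 : ContDiffOn ℂ 1 X U := mod_cast contDiffOn_of_differentiableOn_complex hU hX 1
  obtain ⟨L, hL⟩ := hK.exists_bound_of_continuousOn
    ((hX1.continuousOn_fderiv_of_isOpen hU le_rfl).mono hKU)
  obtain ⟨M, hM⟩ := hK.exists_bound_of_continuousOn (hX.continuousOn.mono hKU)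
  have hspeed : ∀ z ∈ Metric.ball z₀ r, ∀ t ∈ Icc 0 T,
      ‖X (h t z) - X (h s z)‖ ≤ L * M * ‖t - s‖ := by
    intro z hz t ht
    refine Convex.norm_image_sub_le_of_norm_hasDerivWithin_le (f := fun t => X (h t z))
      (f' := fun t => fderiv ℂ X (h t z) (X (h t z))) (fun τ hτ => ?_) (fun τ hτ => ?_)
      (convex_Icc 0 T) hsT' ht
    · have hXd := ((hX.differentiableAt (hU.mem_nhds (hKU (hmem z hz τ hτ)))).hasFDerivAt
        ).restrictScalars ℝ
      exact hXd.comp_hasDerivWithinAt τ ((hode τ (hIcc hτ) z (hrU' hz)).mono hIcc)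
    · have h1 := hL _ (hmem z hz τ hτ)
      exact (ContinuousLinearMap.le_opNorm _ _).trans (mul_le_mul h1 (hM _ (hmem z hz τ hτ))
        (norm_nonneg _) ((norm_nonneg _).trans h1))
  have hrem : ∀ t ∈ Icc 0 T, ∀ z ∈ Metric.ball z₀ r,
      ‖h t z - h s z - (t - s) • X (h s z)‖ ≤ L * M * ‖t - s‖ * ‖t - s‖ := by
    intro t ht z hz
    have hsub : uIcc s t ⊆ Icc 0 T := uIcc_subset_Icc hsT' ht
    have := Convex.norm_image_sub_le_of_norm_hasDerivWithin_le
      (f := fun τ => h τ z - (τ - s) • X (h s z))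
      (f' := fun τ => X (h τ z) - X (h s z)) (s := uIcc s t) (C := L * M * ‖t - s‖)
      (fun τ hτ => ?_) (fun τ hτ => ?_) (convex_uIcc s t) left_mem_uIcc right_mem_uIcc
    · convert this using 2
      simp only [sub_self, zero_smul, sub_zero]
      abel
    · have hlin : HasDerivWithinAt (fun τ : ℝ => (τ - s) • X (h s z)) (X (h s z)) (uIcc s t) τ := by
        simpa using (((hasDerivAt_id τ).sub_const s).smul_const (X (h s z))).hasDerivWithinAt
      exact ((hode τ (hIcc (hsub hτ)) z (hrU' hz)).mono (hsub.trans hIcc)).sub hlin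
    · have hLM : 0 ≤ L * M :=
        mul_nonneg ((norm_nonneg _).trans (hL _ (hmem z hz s hsT')))
          ((norm_nonneg _).trans (hM _ (hmem z hz s hsT')))
      exact (hspeed z hz τ (hsub hτ)).trans
        (mul_le_mul_of_nonneg_left (abs_sub_left_of_mem_uIcc hτ) hLM)
  have hfd : ∀ t ∈ Icc 0 T, ∀ z ∈ Metric.ball z₀ r,
      HasFDerivAt (fun z => h t z - h s z - (t - s) • X (h s z))
        (fderiv ℂ (h t) z - fderiv ℂ (h s) z
          - (t - s) • (fderiv ℂ X (h s z) ∘L fderiv ℂ (h s) z)) z := by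
    intro t ht z hz
    have hd : ∀ t ∈ Icc 0 T, HasFDerivAt (h t) (fderiv ℂ (h t) z) z := fun t ht =>
      ((hhol t (hIcc ht)).differentiableAt (hU'.mem_nhds (hrU' hz))).hasFDerivAt
    have hXd := (hX.differentiableAt (hU.mem_nhds (hmaps s hs z (hrU' hz)))).hasFDerivAt
    exact ((hd t ht).sub (hd s hsT')).sub ((hXd.comp z (hd s hsT')).const_smul (t - s))
  rw [hasDerivWithinAt_iff_isLittleO]
  refine Asymptotics.IsBigO.trans_isLittleO (g := fun t => (t - s) ^ 2)
    (.of_bound (2 * (L * M) / r) ?_) ?_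
  · filter_upwards [self_mem_nhdsWithin, mem_nhdsWithin_of_mem_nhds (Iio_mem_nhds hsT)] with t ht htT
    have htT' : t ∈ Icc 0 T := ⟨ht.1, le_of_lt htT⟩
    rw [← (hfd t htT' z₀ (Metric.mem_ball_self hr)).fderiv]
    refine (norm_fderiv_le_of_forall_mem_ball hr
      (fun z hz => (hfd t htT' z hz).differentiableAt.differentiableWithinAt)
      (hrem t htT')).trans_eq ?_
    rw [norm_pow]
    ring
  · refine .of_norm_left (.mono ?_ nhdsWithin_le_nhds)
    simpa only [norm_pow] using Asymptotics.isLittleO_pow_sub_sub s one_lt_two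

/-- **Derivative of the pullback along a flow**: differentiating the pullback of `v` along the flow
of `X` in time gives the pullback of the Lie bracket of `X` and `v`. -/
theorem hasDerivWithinAt_pullback_flow (hU' : IsOpen U') (hU : IsOpen U)
    (hX : DifferentiableOn ℂ X U) (hv : DifferentiableOn ℂ v U)
    (hmaps : ∀ s ∈ Ico 0 S, ∀ z ∈ U', h s z ∈ U)
    (hhol : ∀ s ∈ Ico 0 S, DifferentiableOn ℂ (h s) U')
    (hode : ∀ s ∈ Ico 0 S, ∀ z ∈ U', HasDerivWithinAt (fun t => h t z) (X (h s z)) (Ico 0 S) s)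
    (hinit : ∀ z ∈ U', h 0 z = z) (hinv : ∀ s ∈ Ico 0 S, ∀ z ∈ U', IsUnit (fderiv ℂ (h s) z))
    {s : ℝ} (hs : s ∈ Ico 0 S) {z : E} (hz : z ∈ U') :
    HasDerivWithinAt (fun t => VectorField.pullback ℂ (h t) v z)
      (VectorField.pullback ℂ (h s) (VectorField.lieBracket ℂ X v) z) (Ico 0 S) s := by
  have : CompleteSpace E := FiniteDimensional.complete ℂ E
  simp only [VectorField.pullback, ← ContinuousLinearMap.ringInverse_eq_inverse]
  obtain ⟨A, hA⟩ := hinv s hs z hz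
  have hvd := ((hv.differentiableAt (hU.mem_nhds (hmaps s hs z hz))).hasFDerivAt).restrictScalars ℝ
  have hvh := hvd.comp_hasDerivWithinAt s (hode s hs z hz)
  have hflow := hasDerivWithinAt_fderiv_flow hU' hU hX hmaps hhol hode hinit hs hz
  have hinvd : HasFDerivAt Ring.inverse
      (-ContinuousLinearMap.mulLeftRight ℝ (E →L[ℂ] E) ↑A⁻¹ ↑A⁻¹) (fderiv ℂ (h s) z) :=
    hA ▸ hasFDerivAt_ringInverse A
  have hN := (ContinuousLinearMap.restrictScalarsL ℂ E E ℝ ℝ).hasFDerivAt.comp_hasDerivWithinAt s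
    (hinvd.comp_hasDerivWithinAt s hflow)
  convert hN.clm_apply hvh using 1
  · rfl
  · have hcancel : (↑A⁻¹ * (fderiv ℂ X (h s z) * ↑A) * ↑A⁻¹ : E →L[ℂ] E)
        = ↑A⁻¹ * fderiv ℂ X (h s z) := by simp [mul_assoc]
    change _ = (-(↑A⁻¹ * (fderiv ℂ X (h s z) * fderiv ℂ (h s) z) * ↑A⁻¹ : E →L[ℂ] E)) (v (h s z))
      + Ring.inverse (fderiv ℂ (h s) z) (fderiv ℂ v (h s z) (X (h s z)))
    rw [← hA, hcancel, Ring.inverse_unit, VectorField.lieBracket, map_sub, sub_eq_neg_add]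
    rfl

/-- A holomorphic field is invariant under its own flow. -/
theorem pullback_flow_self (hU' : IsOpen U') (hU : IsOpen U)
    (hX : DifferentiableOn ℂ X U)
    (hmaps : ∀ s ∈ Ico 0 S, ∀ z ∈ U', h s z ∈ U)
    (hhol : ∀ s ∈ Ico 0 S, DifferentiableOn ℂ (h s) U')
    (hode : ∀ s ∈ Ico 0 S, ∀ z ∈ U', HasDerivWithinAt (fun t => h t z) (X (h s z)) (Ico 0 S) s)
    (hinit : ∀ z ∈ U', h 0 z = z) (hinv : ∀ s ∈ Ico 0 S, ∀ z ∈ U', IsUnit (fderiv ℂ (h s) z))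
    {s : ℝ} (hs : s ∈ Ico 0 S) {z : E} (hz : z ∈ U') :
    VectorField.pullback ℂ (h s) X z = X z := by
  have hderiv : ∀ t ∈ Ico 0 S,
      HasDerivWithinAt (fun t => VectorField.pullback ℂ (h t) X z) 0 (Ico 0 S) t := fun t ht => by
    simpa [VectorField.pullback] using
      hasDerivWithinAt_pullback_flow hU' hU hX hX hmaps hhol hode hinit hinv ht hz
  have hconst := Convex.norm_image_sub_le_of_norm_hasDerivWithin_le hderiv
    (fun t _ => norm_zero.le) (convex_Ico 0 S) ⟨le_rfl, hs.1.trans_lt hs.2⟩ hs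
  rw [zero_mul, norm_le_zero_iff, sub_eq_zero] at hconst
  rw [hconst, pullback_flow_zero hU' hinit hz]

end Flow

/-- **Explicit solution of the truncated averaging equations (formula (f_a_solut)).**
Let `w, v` be holomorphic vector fields on `U ⊆ ℂ^m`, `k ≠ 0`, `σ = sign k`, and let
`h(s,·)` be the flow of the field `iεσ·w` (the complex-time flow `g^{iεσs}` of `w`),
with invertible `z`-derivative.  Then the exponentially damped pullback
`u(z,s) = e^{−|k|s}·(D_z h(s,z))⁻¹(v(h(s,z)))` satisfies `u(·,0) = v` and
`∂_s u = −|k|·u + iεσ·[w,u]`, where `[w,u](z) = Du(z)·w(z) − Dw(z)·u(z)`. -/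
theorem truncated_averaging_explicit_solution
    {m : ℕ} {U' U : Set (EuclideanSpace ℂ (Fin m))}
    (hU'open : IsOpen U') (hUopen : IsOpen U) (hU'U : U' ⊆ U)
    (w v : EuclideanSpace ℂ (Fin m) → EuclideanSpace ℂ (Fin m))
    (hw : DifferentiableOn ℂ w U) (hv : DifferentiableOn ℂ v U)
    (ε : ℝ) (S : ℝ) (hS : 0 < S)
    (k : ℤ) (hk : k ≠ 0) (σ : ℤ) (hσ : σ = Int.sign k)
    (h : ℝ → EuclideanSpace ℂ (Fin m) → EuclideanSpace ℂ (Fin m))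
    (hmaps : ∀ s ∈ Ico (0:ℝ) S, ∀ z ∈ U', h s z ∈ U)
    (hhol : ∀ s ∈ Ico (0:ℝ) S, DifferentiableOn ℂ (h s) U')
    (hode : ∀ s ∈ Ico (0:ℝ) S, ∀ z ∈ U',
      HasDerivWithinAt (fun s' => h s' z)
        ((Complex.I * (ε : ℂ) * (σ : ℂ)) • w (h s z)) (Ico 0 S) s)
    (hinit : ∀ z ∈ U', h 0 z = z)
    (hinv : ∀ s ∈ Ico (0:ℝ) S, ∀ z ∈ U', IsUnit (fderiv ℂ (h s) z))
    (u : EuclideanSpace ℂ (Fin m) → ℝ → EuclideanSpace ℂ (Fin m))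
    (hu : ∀ s ∈ Ico (0:ℝ) S, ∀ z ∈ U',
      u z s = Real.exp (-(|k| : ℝ) * s) •
        (Ring.inverse (fderiv ℂ (h s) z)) (v (h s z))) :
    (∀ z ∈ U', u z 0 = v z) ∧
    (∀ s ∈ Ico (0:ℝ) S, ∀ z ∈ U',
      HasDerivWithinAt (fun s' => u z s')
        ( (-(|k| : ℝ)) • u z s
          + (Complex.I * (ε : ℂ) * (σ : ℂ)) •
              (fderiv ℂ (fun x => u x s) z (w z) - fderiv ℂ w z (u z s)) )
        (Ico 0 S) s) := by
  set c : ℂ := Complex.I * (ε : ℂ) * (σ : ℂ)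
  have hX : DifferentiableOn ℂ (c • w) U := hw.const_smul c
  have hu' : ∀ s ∈ Ico (0:ℝ) S, ∀ z ∈ U',
      u z s = Real.exp (-(|k| : ℝ) * s) • VectorField.pullback ℂ (h s) v z := fun s hs z hz => by
    rw [hu s hs z hz, VectorField.pullback, ContinuousLinearMap.ringInverse_eq_inverse]
  refine ⟨fun z hz => ?_, fun s hs z hz => ?_⟩
  · rw [hu' 0 ⟨le_rfl, hS⟩ z hz, pullback_flow_zero hU'open hinit hz, mul_zero, Real.exp_zero,
      one_smul]
  have hexp : HasDerivWithinAt (fun t : ℝ => Real.exp (-(|k| : ℝ) * t))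
      (Real.exp (-(|k| : ℝ) * s) * -(|k| : ℝ)) (Ico 0 S) s := by
    simpa using ((hasDerivAt_id s).const_mul (-(|k| : ℝ))).exp.hasDerivWithinAt
  have hpull := hasDerivWithinAt_pullback_flow hU'open hUopen hX hv hmaps hhol hode hinit hinv hs hz
  have hbracket : VectorField.pullback ℂ (h s) (VectorField.lieBracket ℂ (c • w) v) z
      = c • VectorField.lieBracket ℂ w (VectorField.pullback ℂ (h s) v) z := by
    have hUs := hUopen.mem_nhds (hmaps s hs z hz)
    rw [VectorField.pullback_lieBracket (n := 2) (by simp)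
      ((contDiffOn_of_differentiableOn_complex hU'open (hhol s hs) 2).contDiffAt
        (hU'open.mem_nhds hz)) (hX.differentiableAt hUs) (hv.differentiableAt hUs),
      Filter.EventuallyEq.lieBracket_vectorField_eq (V := c • w) _ .rfl,
      VectorField.lieBracket_const_smul_left (hw.differentiableAt (hUopen.mem_nhds (hU'U hz)))]
    filter_upwards [hU'open.mem_nhds hz] with y hy using
      pullback_flow_self hU'open hUopen hX hmaps hhol hode hinit hinv hs hy
  have hfderiv : fderiv ℂ (fun x => u x s) z
      = Real.exp (-(|k| : ℝ) * s) • fderiv ℂ (VectorField.pullback ℂ (h s) v) z := by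
    rw [← Pi.smul_apply, ← fderiv_const_smul_field]
    refine Filter.EventuallyEq.fderiv_eq ?_
    filter_upwards [hU'open.mem_nhds hz] with y hy using hu' s hs y hy
  refine ((hexp.smul hpull).congr (fun t ht => hu' t ht z hz) (hu' s hs z hz)).congr_deriv ?_
  rw [hbracket, hfderiv, hu' s hs z hz, VectorField.lieBracket,
    ContinuousLinearMap.map_smul_of_tower]
  simp only [smul_apply, ← smul_sub]
  rw [smul_comm c, smul_smul, add_comm, mul_comm (Real.exp _) (-(|k| : ℝ))]
end
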